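/- (Proposition 3.6) Let f : 𝕎 → ℍ be an M-bilipschitz map, M ≥ 1. For every ε ∈ (0,1] there exist C ≥ 10 depending only on ε and M, and δ > 0 depending only on C, ε and M, such that for all w ∈ 𝕎 and r > 0: if ρ_f(B_par(w,Cr)) < δ, then β_f(B_par(w,r)) < ε. -/

import Mathlib

open scoped ENNReal

namespace HeisRug

/-- The first Heisenberg group, as a set: ℝ³. -/
abbrev Hei : Type := ℝ × ℝ × ℝ

/-- Heisenberg group multiplication. -/
noncomputable def Hmul (p q : Hei) : Hei :=
  (p.1 + q.1, p.2.1 + q.2.1, p.2.2 + q.2.2 + (p.1 * q.2.1 - q.1 * p.2.1) / 2)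

/-- Heisenberg group inverse. -/
def Hinv (p : Hei) : Hei := (-p.1, -p.2.1, -p.2.2)

/-- Homogeneous norm on the Heisenberg group. -/
noncomputable def Hnorm (p : Hei) : ℝ :=
  max (Real.sqrt (p.1 ^ 2 + p.2.1 ^ 2)) (Real.sqrt |p.2.2|)

/-- Left-invariant metric `d(p,q) = ‖q⁻¹·p‖` on the Heisenberg group. -/
noncomputable def dH (p q : Hei) : ℝ := Hnorm (Hmul (Hinv q) p)

/-- Parabolic metric on the parabolic plane 𝕎 = ℝ². -/
noncomputable def dPar (w w' : ℝ × ℝ) : ℝ :=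
  max |w.1 - w'.1| (Real.sqrt |w.2 - w'.2|)

/-- Distance from a point to a set in (ℍ, d). -/
noncomputable def distH (p : Hei) (E : Set Hei) : ℝ := sInf ((dH p) '' E)

/-- Closed δ-neighbourhood of a set in ℍ. -/
def NH (E : Set Hei) (δ : ℝ) : Set Hei := {p | distH p E ≤ δ}

/-- Closed ball in (ℍ, d). -/
def BH (p : Hei) (r : ℝ) : Set Hei := {q | dH q p ≤ r}

/-- Closed parabolic ball in 𝕎. -/
def BPar (w : ℝ × ℝ) (r : ℝ) : Set (ℝ × ℝ) := {v | dPar v w ≤ r}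

/-- Diameter (in ℝ≥0∞) with respect to the Heisenberg metric. -/
noncomputable def ediamH (E : Set Hei) : ℝ≥0∞ :=
  ⨆ p ∈ E, ⨆ q ∈ E, ENNReal.ofReal (dH p q)

/-- The 3-dimensional Hausdorff measure on (ℍ, d), as a set function. -/
noncomputable def H3 (E : Set Hei) : ℝ≥0∞ :=
  ⨆ (δ : ℝ≥0∞) (_ : 0 < δ),
    ⨅ (U : ℕ → Set Hei) (_ : E ⊆ ⋃ n, U n) (_ : ∀ n, ediamH (U n) ≤ δ),
      ∑' n, ediamH (U n) ^ 3

/-- Isometric embedding of the parabolic plane onto the subgroup 𝕎 ⊂ ℍ. -/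
def embedW (w : ℝ × ℝ) : Hei := (0, w.1, w.2)

/-- The vertical subgroup 𝕎 = {(0,y,t)} of ℍ. -/
def Wsub : Set Hei := {p | p.1 = 0}

/-- Rotation by angle θ about the t-axis. -/
noncomputable def Rrot (θ : ℝ) (p : Hei) : Hei :=
  (p.1 * Real.cos θ - p.2.1 * Real.sin θ, p.1 * Real.sin θ + p.2.1 * Real.cos θ, p.2.2)

/-- Vertical projection Π : ℍ → 𝕎. -/
noncomputable def Piproj (p : Hei) : Hei := (0, p.2.1, p.2.2 + p.1 * p.2.1 / 2)

/-- Horizontal projection Π_𝕃 : ℍ → 𝕃. -/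
def PiL (p : Hei) : Hei := (p.1, 0, 0)

/-- Vertical projection Π_θ = R_θ ∘ Π ∘ R_θ⁻¹ onto 𝕎_θ. -/
noncomputable def PiTheta (θ : ℝ) (p : Hei) : Hei := Rrot θ (Piproj (Rrot (-θ) p))

/-- `f : 𝕎 → ℍ` is M-bilipschitz. -/
def IsBilipschitz (M : ℝ) (f : ℝ × ℝ → Hei) : Prop :=
  ∀ w w' : ℝ × ℝ,
    M⁻¹ * dPar w w' ≤ dH (f w) (f w') ∧ dH (f w) (f w') ≤ M * dPar w w'

/-- A Rickman rug: the image of the parabolic plane under a bilipschitz map. -/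
def IsRickmanRug (E : Set Hei) : Prop :=
  ∃ M : ℝ, 1 ≤ M ∧ ∃ f : ℝ × ℝ → Hei, IsBilipschitz M f ∧ E = Set.range f

/-- A horizontal line in ℍ. -/
def IsHorizontalLine (L : Set Hei) : Prop :=
  ∃ p : Hei, ∃ v : ℝ × ℝ, v ≠ 0 ∧
    L = {q | ∃ s : ℝ, q = Hmul p (s * v.1, s * v.2, 0)}

/-- The vertical plane spanned by a horizontal line. -/
def VSpan (L : Set Hei) : Set Hei := {q | ∃ p ∈ L, ∃ t : ℝ, q = Hmul p (0, 0, t)}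

/-- Vertical planes in ℍ. -/
def IsVerticalPlane (V : Set Hei) : Prop :=
  ∃ L : Set Hei, IsHorizontalLine L ∧ V = VSpan L

/-- The horizontal line {(a·y + b, y, b·y/2 + c) : y ∈ ℝ} (of slope |a|). -/
def hline (a b c : ℝ) : Set Hei :=
  {p | ∃ y : ℝ, p = (a * y + b, y, b * y / 2 + c)}

/-- A horizontal line of (finite) slope at most Σ. -/
def HLineSlopeLe (S : ℝ) (L : Set Hei) : Prop :=
  ∃ a b c : ℝ, |a| ≤ S ∧ L = hline a b c

/-- A vertical plane of (finite) slope at most Σ (relative to 𝕎). -/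
def VPlaneSlopeLe (S : ℝ) (V : Set Hei) : Prop :=
  ∃ a b : ℝ, |a| ≤ S ∧ V = {p : Hei | p.1 = a * p.2.1 + b}

/-- A vertical plane whose slope relative to 𝕎_θ equals 0. -/
def SlopeZeroRel (θ : ℝ) (V : Set Hei) : Prop :=
  ∃ b : ℝ, Rrot (-θ) '' V = {p : Hei | p.1 = b}

/-- The horizontal line ℝ × {t} in the parabolic plane. -/
def lineW (t : ℝ) : Set (ℝ × ℝ) := {w | w.2 = t}

/-- Ruler coefficient ρ_f(B_par(w,r)). -/
noncomputable def rulerCoef (f : ℝ × ℝ → Hei) (w : ℝ × ℝ) (r : ℝ) : ℝ :=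
  sInf {ρ : ℝ | 0 < ρ ∧ ∀ t : ℝ, ∃ L : Set Hei, IsHorizontalLine L ∧
    f '' (lineW t ∩ BPar w r) ⊆ NH L (ρ * r)}

/-- β_f(𝕍; B_par(w,r)): approximation number relative to the vertical plane 𝕍. -/
noncomputable def betaV (f : ℝ × ℝ → Hei) (V : Set Hei) (w : ℝ × ℝ) (r : ℝ) : ℝ :=
  sInf {ε : ℝ | 0 < ε ∧ ∀ t : ℝ, ∃ L : Set Hei, IsHorizontalLine L ∧ L ⊆ V ∧
    f '' (lineW t ∩ BPar w r) ⊆ NH L (ε * r)}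

/-- The strong vertical β-number β_f(B_par(w,r)) = inf_𝕍 β_f(𝕍; B_par(w,r)). -/
noncomputable def beta (f : ℝ × ℝ → Hei) (w : ℝ × ℝ) (r : ℝ) : ℝ :=
  sInf {b : ℝ | ∃ V : Set Hei, IsVerticalPlane V ∧ b = betaV f V w r}

/-- Index set for dyadic parabolic rectangles: (n, k, l). -/
abbrev Idx : Type := ℤ × ℤ × ℤ

/-- Side length ℓ(Q) = 2⁻ⁿ of the dyadic parabolic rectangle with index (n,k,l). -/
noncomputable def sideLen (i : Idx) : ℝ := (2 : ℝ) ^ (-i.1)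

/-- The dyadic parabolic rectangle [k·2⁻ⁿ, (k+1)·2⁻ⁿ) × [l·4⁻ⁿ, (l+1)·4⁻ⁿ). -/
noncomputable def rect (i : Idx) : Set (ℝ × ℝ) :=
  Set.Ico ((i.2.1 : ℝ) * (2 : ℝ) ^ (-i.1)) (((i.2.1 : ℝ) + 1) * (2 : ℝ) ^ (-i.1)) ×ˢ
  Set.Ico ((i.2.2 : ℝ) * (4 : ℝ) ^ (-i.1)) (((i.2.2 : ℝ) + 1) * (4 : ℝ) ^ (-i.1))

/-- The centre c_Q of a dyadic parabolic rectangle. -/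
noncomputable def center (i : Idx) : ℝ × ℝ :=
  (((i.2.1 : ℝ) + 1 / 2) * (2 : ℝ) ^ (-i.1), ((i.2.2 : ℝ) + 1 / 2) * (4 : ℝ) ^ (-i.1))

/-- λQ := B_par(c_Q, λ·ℓ(Q)). -/
noncomputable def dilate (lam : ℝ) (i : Idx) : Set (ℝ × ℝ) := BPar (center i) (lam * sideLen i)

/-- j indexes a 𝒟-child of the rectangle indexed by i. -/
def IsChild (j i : Idx) : Prop := j.1 = i.1 + 1 ∧ rect j ⊆ rect i

/-- T ⊆ 𝒟 is a tree with root rt. -/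
def IsTreeWithRoot (T : Set Idx) (rt : Idx) : Prop :=
  rt ∈ T ∧ (∀ i ∈ T, rect i ⊆ rect rt) ∧
  (∀ i j k : Idx, i ∈ T → k ∈ T → rect i ⊆ rect j → rect j ⊆ rect k → j ∈ T) ∧
  (∀ i ∈ T, (∀ j : Idx, IsChild j i → j ∈ T) ∨ (∀ j : Idx, IsChild j i → j ∉ T))

/-- T ⊆ 𝒟 is a tree. -/
def IsTree (T : Set Idx) : Prop := ∃ rt : Idx, IsTreeWithRoot T rt

/-- Q is (ε,H,Σ)-vertical for f : there is a vertical plane 𝕍_Q of slope ≤ Σ with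
β_f(𝕍_Q; HQ) < ε/H. -/
def IsVerticalRect (f : ℝ × ℝ → Hei) (ε Hc S : ℝ) (i : Idx) : Prop :=
  ∃ V : Set Hei, VPlaneSlopeLe S V ∧ betaV f V (center i) (Hc * sideLen i) < ε / Hc

/-- Q is (δ,C)-ruled for f. -/
def IsRuled (f : ℝ × ℝ → Hei) (δ C : ℝ) (i : Idx) : Prop :=
  ∀ t : ℝ, ∃ L : Set Hei, IsHorizontalLine L ∧
    f '' (lineW t ∩ dilate C i) ⊆ NH L (δ * sideLen i)

/-- Q is (δ,C,Σ)-ruled for f. -/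
def IsRuledSlope (f : ℝ × ℝ → Hei) (δ C S : ℝ) (i : Idx) : Prop :=
  IsRuled f δ C i ∧ ∃ t : ℝ, (lineW t ∩ rect i).Nonempty ∧
    ∃ L : Set Hei, HLineSlopeLe S L ∧
      f '' (lineW t ∩ dilate C i) ⊆ NH L (δ * sideLen i)

/-- Γ is an intrinsic L-Lipschitz graph over 𝕎. -/
def IsIntrinsicLipGraph (L : ℝ) (Γ : Set Hei) : Prop :=
  Set.BijOn Piproj Γ Wsub ∧
  ∀ p ∈ Γ, ∀ q ∈ Γ,
    Hnorm (PiL (Hmul (Hinv q) p)) ≤ L * Hnorm (Piproj (Hmul (Hinv q) p))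

/-- Γ is an intrinsic L-Lipschitz graph over 𝕎_θ. -/
def IsIntrinsicLipGraphOver (θ L : ℝ) (Γ : Set Hei) : Prop :=
  IsIntrinsicLipGraph L (Rrot (-θ) '' Γ)

/-- An intrinsic bilipschitz graph: an intrinsic Lipschitz graph over some vertical
subgroup which is also a Rickman rug. -/
def IsIntrinsicBilipGraph (Γ : Set Hei) : Prop :=
  (∃ θ ∈ Set.Ico (-(Real.pi / 2)) (Real.pi / 2), ∃ L : ℝ, 1 ≤ L ∧
    IsIntrinsicLipGraphOver θ L Γ) ∧ IsRickmanRug Γ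

/-- (M,ε)-quasi-isometric embedding between sets with distance functions. -/
def IsQIEOn {X Y : Type*} (dX : X → X → ℝ) (dY : Y → Y → ℝ) (A : Set X)
    (M ε : ℝ) (F : X → Y) : Prop :=
  ∀ x ∈ A, ∀ x' ∈ A,
    M⁻¹ * dX x x' - ε ≤ dY (F x) (F x') ∧ dY (F x) (F x') ≤ M * dX x x' + ε

/-- d is a metric on ℝ. -/
def IsMetricOn (d : ℝ → ℝ → ℝ) : Prop :=
  (∀ x y, d x y = d y x) ∧ (∀ x y, d x y = 0 ↔ x = y) ∧
  (∀ x y z, d x z ≤ d x y + d y z)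

/-- d is an orderly metric on ℝ. -/
def Orderly (d : ℝ → ℝ → ℝ) : Prop :=
  IsMetricOn d ∧
  (∀ x : ℝ, ∀ ε > (0 : ℝ), ∃ δ > (0 : ℝ), ∀ y : ℝ, |x - y| < δ → d x y < ε) ∧
  (∀ x y z : ℝ, x ≤ y → y ≤ z → max (d x y) (d y z) ≤ d x z)

/-- F : I×J → 𝕎 is a horizontal (M,ε)-QIE. -/
def IsHorizQIE (M ε : ℝ) (I J : Set ℝ) (F : ℝ × ℝ → ℝ × ℝ) : Prop :=
  IsQIEOn dPar dPar (I ×ˢ J) M ε F ∧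
  (∀ t ∈ J, ∃ c : ℝ, ∀ y ∈ I, (F (y, t)).2 = c)



/-! ### Auxiliary facts -/

/-- Contact-type expression appearing in the vertical component of `q⁻¹ · p`. -/
lemma dH_le_iff (p q : Hei) (K : ℝ) (hK : 0 ≤ K) :
    dH p q ≤ K ↔ (p.1 - q.1) ^ 2 + (p.2.1 - q.2.1) ^ 2 ≤ K ^ 2 ∧
      |p.2.2 - q.2.2 + (p.1 * q.2.1 - q.1 * p.2.1) / 2| ≤ K ^ 2 := by
  unfold dH Hnorm Hmul Hinv
  simp only [max_le_iff]
  rw [Real.sqrt_le_left hK, Real.sqrt_le_left hK]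
  have e1 : (-q.1 + p.1) ^ 2 + (-q.2.1 + p.2.1) ^ 2
      = (p.1 - q.1) ^ 2 + (p.2.1 - q.2.1) ^ 2 := by ring
  have e2 : -q.2.2 + p.2.2 + (-q.1 * p.2.1 - p.1 * -q.2.1) / 2
      = p.2.2 - q.2.2 + (p.1 * q.2.1 - q.1 * p.2.1) / 2 := by ring
  rw [e1, e2]

lemma dH_nonneg (p q : Hei) : 0 ≤ dH p q :=
  le_max_of_le_left (Real.sqrt_nonneg _)

lemma dH_comm (p q : Hei) : dH p q = dH q p := by
  have key : ∀ p q : Hei, dH p q ≤ dH q p := by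
    intro p q
    obtain ⟨h1, h2⟩ := (dH_le_iff q p _ (dH_nonneg q p)).1 le_rfl
    refine (dH_le_iff p q _ (dH_nonneg q p)).2 ⟨by nlinarith, ?_⟩
    rw [abs_le] at h2 ⊢
    constructor <;> linarith [h2.1, h2.2]
  exact le_antisymm (key p q) (key q p)

lemma cross_bound {x y u v A B : ℝ} (hA : 0 ≤ A) (hB : 0 ≤ B)
    (h1 : x ^ 2 + y ^ 2 ≤ A ^ 2) (h2 : u ^ 2 + v ^ 2 ≤ B ^ 2) :
    |x * u + y * v| ≤ A * B := by
  apply abs_le_of_sq_le_sq _ (by positivity)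
  have h3 : (x * u + y * v) ^ 2 ≤ (x ^ 2 + y ^ 2) * (u ^ 2 + v ^ 2) := by
    nlinarith [sq_nonneg (x * v - y * u)]
  have h4 : (x ^ 2 + y ^ 2) * (u ^ 2 + v ^ 2) ≤ A ^ 2 * B ^ 2 :=
    mul_le_mul h1 h2 (by positivity) (by positivity)
  nlinarith

lemma dH_triangle (p q z : Hei) : dH p z ≤ dH p q + dH q z := by
  have hA := dH_nonneg p q
  have hB := dH_nonneg q z
  obtain ⟨a1, a2⟩ := (dH_le_iff p q _ hA).1 le_rfl
  obtain ⟨b1, b2⟩ := (dH_le_iff q z _ hB).1 le_rfl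
  set A := dH p q
  set B := dH q z
  refine (dH_le_iff p z _ (by positivity)).2 ⟨?_, ?_⟩
  · have := (abs_le.1 (cross_bound hA hB a1 b1)).2
    nlinarith
  · have b1' : (q.2.1 - z.2.1) ^ 2 + (-(q.1 - z.1)) ^ 2 ≤ B ^ 2 := by nlinarith
    have := abs_le.1 (cross_bound hA hB a1 b1')
    rw [abs_le] at a2 b2 ⊢
    constructor <;> nlinarith

/-- Component orthogonal to the line `p · ℝv`. -/
def perpC (p : Hei) (v : ℝ × ℝ) (q : Hei) : ℝ :=
  -(q.1 - p.1) * v.2 + (q.2.1 - p.2.1) * v.1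

/-- Component along the line `p · ℝv`. -/
def alongC (p : Hei) (v : ℝ × ℝ) (q : Hei) : ℝ :=
  (q.1 - p.1) * v.1 + (q.2.1 - p.2.1) * v.2

/-- Vertical component after projection to the vertical plane through `p · ℝv`. -/
noncomputable def vertC (p : Hei) (v : ℝ × ℝ) (q : Hei) : ℝ :=
  q.2.2 - p.2.2 + (q.1 * p.2.1 - p.1 * q.2.1) / 2 - alongC p v q * perpC p v q / 2

/-- The point `p · (sv, c)`. -/
noncomputable def pt (p : Hei) (v : ℝ × ℝ) (c s : ℝ) : Hei := Hmul p (s * v.1, s * v.2, c)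

lemma near_line {p : Hei} {v : ℝ × ℝ} (hv : v.1 ^ 2 + v.2 ^ 2 = 1) {q : Hei} {s K : ℝ}
    (hK : 0 ≤ K) (h : dH q (pt p v 0 s) ≤ K) :
    |perpC p v q| ≤ K ∧ |vertC p v q| ≤ 2 * K ^ 2 := by
  obtain ⟨h1, h2⟩ := (dH_le_iff _ _ _ hK).1 h
  have e1 : (alongC p v q - s) ^ 2 + (perpC p v q) ^ 2 ≤ K ^ 2 := by
    refine le_trans (le_of_eq ?_) h1
    simp only [alongC, perpC, pt, Hmul]
    linear_combination ((q.1 - p.1) ^ 2 + (q.2.1 - p.2.1) ^ 2 - s ^ 2) * hv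
  have e2 : q.2.2 - (pt p v 0 s).2.2 + (q.1 * (pt p v 0 s).2.1 - (pt p v 0 s).1 * q.2.1) / 2
      = vertC p v q + (alongC p v q - s) * perpC p v q / 2 := by
    simp only [vertC, alongC, perpC, pt, Hmul]
    ring
  rw [e2] at h2
  refine ⟨abs_le_of_sq_le_sq (by nlinarith [sq_nonneg (alongC p v q - s)]) hK, ?_⟩
  rw [abs_le] at h2 ⊢
  constructor
  · nlinarith [sq_nonneg (alongC p v q - s + perpC p v q),
      sq_nonneg (alongC p v q - s - perpC p v q)]
  · nlinarith [sq_nonneg (alongC p v q - s + perpC p v q),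
      sq_nonneg (alongC p v q - s - perpC p v q)]

lemma close_line {p : Hei} {v : ℝ × ℝ} (hv : v.1 ^ 2 + v.2 ^ 2 = 1) {q : Hei} {c K : ℝ}
    (hK : 0 ≤ K) (h1 : |perpC p v q| ≤ K) (h2 : |vertC p v q - c| ≤ K ^ 2) :
    dH q (pt p v c (alongC p v q)) ≤ K := by
  refine (dH_le_iff _ _ _ hK).2 ⟨?_, ?_⟩
  · have := sq_le_sq' (abs_le.1 h1).1 (abs_le.1 h1).2
    refine le_trans (le_of_eq ?_) this
    simp only [alongC, perpC, pt, Hmul]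
    linear_combination (-(q.1 - p.1) ^ 2 - (q.2.1 - p.2.1) ^ 2 +
      ((q.1 - p.1) * v.1 + (q.2.1 - p.2.1) * v.2) ^ 2) * hv
  · refine le_trans (le_of_eq ?_) h2
    congr 1
    simp only [vertC, alongC, perpC, pt, Hmul]
    ring

lemma perp_pt (p p' : Hei) (v v' : ℝ × ℝ) (s : ℝ) :
    perpC p v (pt p' v' 0 s) = perpC p v p' + (-v'.1 * v.2 + v'.2 * v.1) * s := by
  simp only [perpC, pt, Hmul]
  ring

lemma vert_pt (p p' : Hei) (v v' : ℝ × ℝ) (hv : v.1 ^ 2 + v.2 ^ 2 = 1) (s : ℝ) :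
    vertC p v (pt p' v' 0 s) = vertC p v p' - (v'.1 * v.1 + v'.2 * v.2) *
      (perpC p v p' * s + (-v'.1 * v.2 + v'.2 * v.1) * s ^ 2 / 2) := by
  simp only [vertC, alongC, perpC, pt, Hmul]
  linear_combination (s * ((p'.1 - p.1) * v'.2 - (p'.2.1 - p.2.1) * v'.1) / 2) * (-hv)

lemma dH_pt (p : Hei) (v : ℝ × ℝ) (hv : v.1 ^ 2 + v.2 ^ 2 = 1) (s s' : ℝ) :
    dH (pt p v 0 s) (pt p v 0 s') = |s - s'| := by
  have e : ∀ K, 0 ≤ K → (dH (pt p v 0 s) (pt p v 0 s') ≤ K ↔ |s - s'| ≤ K) := by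
    intro K hK
    rw [dH_le_iff _ _ _ hK]
    have e1 : ((pt p v 0 s).1 - (pt p v 0 s').1) ^ 2 +
        ((pt p v 0 s).2.1 - (pt p v 0 s').2.1) ^ 2 = (s - s') ^ 2 := by
      simp only [pt, Hmul]
      linear_combination (s - s') ^ 2 * hv
    have e2 : (pt p v 0 s).2.2 - (pt p v 0 s').2.2 +
        ((pt p v 0 s).1 * (pt p v 0 s').2.1 - (pt p v 0 s').1 * (pt p v 0 s).2.1) / 2 = 0 := by
      simp only [pt, Hmul]
      ring
    rw [e1, e2, abs_zero]
    constructor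
    · rintro ⟨h, -⟩
      exact abs_le_of_sq_le_sq h hK
    · intro h
      exact ⟨sq_le_sq' (abs_le.1 h).1 (abs_le.1 h).2, by positivity⟩
  exact le_antisymm ((e _ (abs_nonneg _)).2 le_rfl) ((e _ (dH_nonneg _ _)).1 le_rfl)

lemma line_unit {L : Set Hei} (h : IsHorizontalLine L) :
    ∃ p : Hei, ∃ v : ℝ × ℝ, v.1 ^ 2 + v.2 ^ 2 = 1 ∧ L = Set.range (pt p v 0) := by
  obtain ⟨p, v, hv, rfl⟩ := h
  have hpos : 0 < v.1 ^ 2 + v.2 ^ 2 := by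
    by_contra hn
    apply hv
    have h1 : v.1 = 0 := by nlinarith [sq_nonneg v.1, sq_nonneg v.2]
    have h2 : v.2 = 0 := by nlinarith [sq_nonneg v.1, sq_nonneg v.2]
    exact Prod.ext h1 h2
  set n := Real.sqrt (v.1 ^ 2 + v.2 ^ 2) with hn
  have hnpos : 0 < n := Real.sqrt_pos.2 hpos
  have hn2 : n ^ 2 = v.1 ^ 2 + v.2 ^ 2 := Real.sq_sqrt hpos.le
  refine ⟨p, (v.1 / n, v.2 / n), ?_, ?_⟩
  · simp only
    rw [div_pow, div_pow, ← add_div, hn2, div_self hpos.ne']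
  · ext q
    simp only [Set.mem_setOf_eq, Set.mem_range, pt]
    constructor
    · rintro ⟨s, rfl⟩
      refine ⟨s * n, ?_⟩
      congr 2
      · field_simp
      · congr 1
        field_simp
    · rintro ⟨s, rfl⟩
      refine ⟨s / n, ?_⟩
      congr 2
      · field_simp
      · congr 1
        field_simp

lemma isLine_pt (p : Hei) (v : ℝ × ℝ) (hv : v.1 ^ 2 + v.2 ^ 2 = 1) (c : ℝ) :
    IsHorizontalLine (Set.range (pt p v c)) := by
  refine ⟨Hmul p (0, 0, c), v, ?_, ?_⟩
  · rintro rfl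
    simp at hv
  · ext q
    simp only [Set.mem_setOf_eq, Set.mem_range, pt, Hmul]
    constructor
    · rintro ⟨s, rfl⟩
      exact ⟨s, by ext <;> simp⟩
    · rintro ⟨s, rfl⟩
      exact ⟨s, by ext <;> simp⟩

lemma pt_sub_span (p : Hei) (v : ℝ × ℝ) (c : ℝ) :
    Set.range (pt p v c) ⊆ VSpan (Set.range (pt p v 0)) := by
  rintro _ ⟨s, rfl⟩
  exact ⟨_, ⟨s, rfl⟩, c, by ext <;> simp [pt, Hmul] <;> ring⟩

lemma mem_NH {q z : Hei} {E : Set Hei} {K : ℝ} (hz : z ∈ E) (h : dH q z ≤ K) : q ∈ NH E K := by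
  have hbd : BddBelow ((dH q) '' E) := by
    refine ⟨0, ?_⟩
    rintro _ ⟨z, -, rfl⟩
    exact dH_nonneg _ _
  exact le_trans (csInf_le hbd ⟨z, hz, rfl⟩) h

lemma exists_of_NH {q : Hei} {E : Set Hei} (hE : E.Nonempty) {K K' : ℝ} (h : q ∈ NH E K)
    (hK : K < K') : ∃ z ∈ E, dH q z < K' := by
  have h' : sInf ((dH q) '' E) < K' := lt_of_le_of_lt h hK
  obtain ⟨_, ⟨z, hz, rfl⟩, hlt⟩ := exists_lt_of_csInf_lt (hE.image _) h'
  exact ⟨z, hz, hlt⟩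

/-- The quantitative core: three far away points of a horizontal line which are close to a
fixed line. -/
lemma core {β T c σ K Λ D s₀ s₁ s₂ : ℝ} (hc : c ^ 2 + σ ^ 2 = 1) (hΛ : 0 < Λ)
    (hK : 0 ≤ K) (h4 : 4 * K ≤ Λ)
    (hb1 : |β + σ * s₁| ≤ K) (hb2 : |β + σ * s₂| ≤ K)
    (hT0 : |T - c * (β * s₀ + σ * s₀ ^ 2 / 2)| ≤ 2 * K ^ 2)
    (hT1 : |T - c * (β * s₁ + σ * s₁ ^ 2 / 2)| ≤ 2 * K ^ 2)
    (hT2 : |T - c * (β * s₂ + σ * s₂ ^ 2 / 2)| ≤ 2 * K ^ 2)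
    (h01 : Λ ≤ |s₀ - s₁|) (h02 : Λ ≤ |s₀ - s₂|) (h12 : Λ ≤ |s₁ - s₂|)
    (hD : |s₀ - s₁| ≤ D) :
    |β + σ * s₀| ≤ 8 * K ^ 2 / Λ + 16 * K ^ 2 * D / Λ ^ 2 := by
  have hσ : |σ| ≤ 1 / 2 := by
    have h : |σ| * |s₁ - s₂| ≤ 2 * K := by
      rw [← abs_mul]
      have : σ * (s₁ - s₂) = (β + σ * s₁) - (β + σ * s₂) := by ring
      rw [this]
      linarith [abs_sub (β + σ * s₁) (β + σ * s₂)]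
    have h' : |σ| * Λ ≤ |σ| * |s₁ - s₂| := mul_le_mul_of_nonneg_left h12 (abs_nonneg _)
    by_contra hh
    push Not at hh
    nlinarith
  have hc2 : 1 / 2 ≤ |c| := by
    have : σ ^ 2 ≤ 1 / 4 := by
      rw [← sq_abs]
      nlinarith [abs_nonneg σ]
    by_contra hh
    push Not at hh
    have : c ^ 2 ≤ 1 / 4 := by
      rw [← sq_abs]
      nlinarith [abs_nonneg c]
    linarith
  have mid : ∀ s, |T - c * (β * s + σ * s ^ 2 / 2)| ≤ 2 * K ^ 2 → Λ ≤ |s₀ - s| →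
      |β + σ * (s₀ + s) / 2| ≤ 8 * K ^ 2 / Λ := by
    intro s hTs hs
    rw [le_div_iff₀ hΛ]
    have h : |c| * (|s₀ - s| * |β + σ * (s₀ + s) / 2|) ≤ 4 * K ^ 2 := by
      rw [← abs_mul, ← abs_mul]
      have : c * ((s₀ - s) * (β + σ * (s₀ + s) / 2)) =
        (T - c * (β * s + σ * s ^ 2 / 2)) - (T - c * (β * s₀ + σ * s₀ ^ 2 / 2)) := by ring
      rw [this]
      refine le_trans (abs_sub _ _) (by linarith)
    have hx := abs_nonneg (β + σ * (s₀ + s) / 2)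
    have g1 : Λ * |β + σ * (s₀ + s) / 2| ≤ |s₀ - s| * |β + σ * (s₀ + s) / 2| :=
      mul_le_mul_of_nonneg_right hs hx
    have g2 : 1 / 2 * (|s₀ - s| * |β + σ * (s₀ + s) / 2|) ≤
        |c| * (|s₀ - s| * |β + σ * (s₀ + s) / 2|) :=
      mul_le_mul_of_nonneg_right hc2 (by positivity)
    linarith
  have m1 := mid s₁ hT1 h01
  have m2 := mid s₂ hT2 h02
  set m := 8 * K ^ 2 / Λ with hm
  have hmn : 0 ≤ m := by positivity
  have hσ2 : |σ| ≤ 4 * m / Λ := by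
    rw [le_div_iff₀ hΛ]
    have h : |σ| * |s₁ - s₂| ≤ 4 * m := by
      rw [← abs_mul]
      have : σ * (s₁ - s₂) = 2 * ((β + σ * (s₀ + s₁) / 2) - (β + σ * (s₀ + s₂) / 2)) := by ring
      rw [this, abs_mul, abs_two]
      linarith [abs_sub (β + σ * (s₀ + s₁) / 2) (β + σ * (s₀ + s₂) / 2)]
    exact le_trans (mul_le_mul_of_nonneg_left h12 (abs_nonneg _)) h
  have e : β + σ * s₀ = (β + σ * (s₀ + s₁) / 2) + σ * (s₀ - s₁) / 2 := by ring
  rw [e]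
  have h2 : |σ * (s₀ - s₁) / 2| ≤ (4 * m / Λ) * D / 2 := by
    rw [abs_div, abs_two, abs_mul]
    have := mul_le_mul hσ2 hD (abs_nonneg _) (by positivity)
    linarith
  have h3 : (4 * m / Λ) * D / 2 = 16 * K ^ 2 * D / Λ ^ 2 := by
    rw [hm]
    field_simp
    ring
  rw [h3] at h2
  exact le_trans (abs_add_le _ _) (add_le_add m1 h2)

lemma dPar_same_t (y y' t : ℝ) : dPar (y, t) (y', t) = |y - y'| := by
  simp [dPar]

lemma dPar_same_y (y t t' : ℝ) : dPar (y, t) (y, t') = Real.sqrt |t - t'| := by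
  simp [dPar]

set_option maxHeartbeats 2000000 in
lemma key {M ε C r : ℝ} (hM : 1 ≤ M) (hε : 0 < ε) (hε1 : ε ≤ 1)
    (hC : C = 40000 * M ^ 6 / ε ^ 2) (hr : 0 < r) {f : ℝ × ℝ → Hei} (hf : IsBilipschitz M f)
    (w : ℝ × ℝ) {ρ : ℝ} (hρ : ρ * (C * r) < ε * r / 8)
    (hrul : ∀ t : ℝ, ∃ L : Set Hei, IsHorizontalLine L ∧
      f '' (lineW t ∩ BPar w (C * r)) ⊆ NH L (ρ * (C * r))) :
    ∃ V, IsVerticalPlane V ∧ ∀ t : ℝ, ∃ L : Set Hei, IsHorizontalLine L ∧ L ⊆ V ∧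
      f '' (lineW t ∩ BPar w r) ⊆ NH L (ε / 2 * r) := by
  have hM0 : 0 < M := by linarith
  have hM6 : 1 ≤ M ^ 6 := one_le_pow₀ hM
  have hε2 : ε ^ 2 ≤ 1 := pow_le_one₀ hε.le hε1
  have hCε : C * ε ^ 2 = 40000 * M ^ 6 := by rw [hC]; field_simp
  have hC0 : 0 < C := by rw [hC]; positivity
  have hC1 : 40000 * M ^ 6 ≤ C := by rw [← hCε]; nlinarith
  have hM2 : M ^ 2 ≤ M ^ 6 := pow_le_pow_right₀ hM (by norm_num)
  have hM1 : M ≤ M ^ 2 := by nlinarith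
  have hrC : r ≤ C * r := by nlinarith
  -- points on the ruling lines
  have hnear : ∀ (L : Set Hei) (t : ℝ), IsHorizontalLine L →
      f '' (lineW t ∩ BPar w (C * r)) ⊆ NH L (ρ * (C * r)) → |t - w.2| ≤ r ^ 2 →
      ∀ y, |y - w.1| ≤ C * r → ∃ z ∈ L, dH (f (y, t)) z < ε * r / 8 := by
    intro L t hL hsub ht y hy
    have hne : L.Nonempty := by
      obtain ⟨p, v, -, rfl⟩ := line_unit hL
      exact ⟨_, 0, rfl⟩
    refine exists_of_NH hne (hsub ⟨(y, t), ⟨rfl, ?_⟩, rfl⟩) hρ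
    refine max_le hy ?_
    refine Real.sqrt_le_iff.2 ⟨by positivity, le_trans ht ?_⟩
    have : r ≤ C * r := by nlinarith
    exact pow_le_pow_left₀ hr.le this 2
  obtain ⟨L₀, hL₀, hsub₀⟩ := hrul w.2
  obtain ⟨p, v, hv, hLeq⟩ := line_unit hL₀
  have hnear₀ := hnear L₀ w.2 hL₀ hsub₀ (by simp; positivity)
  refine ⟨VSpan L₀, ⟨L₀, hL₀, rfl⟩, ?_⟩
  intro t
  by_cases ht : |t - w.2| ≤ r ^ 2
  swap
  · refine ⟨L₀, hL₀, ?_, ?_⟩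
    · nth_rewrite 1 [hLeq]
      rw [hLeq]
      exact pt_sub_span p v 0
    · rintro _ ⟨x, ⟨hx1, hx2⟩, rfl⟩
      exfalso
      apply ht
      have h2 : Real.sqrt |x.2 - w.2| ≤ r := le_trans (le_max_right _ _) hx2
      rw [Real.sqrt_le_left hr.le] at h2
      have h3 : x.2 = t := hx1
      rwa [h3] at h2
  obtain ⟨L, hL, hsub⟩ := hrul t
  obtain ⟨p', v', hv', hLeq'⟩ := line_unit hL
  have hnt := hnear L t hL hsub ht
  -- parametrise
  have hpar : ∀ y, |y - w.1| ≤ C * r → ∃ s, dH (f (y, t)) (pt p' v' 0 s) < ε * r / 8 := by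
    intro y hy
    obtain ⟨z, hz, h⟩ := hnt y hy
    rw [hLeq'] at hz
    obtain ⟨s, rfl⟩ := hz
    exact ⟨s, h⟩
  have hεr : ε * r ≤ r := by nlinarith
  have hcl : ∀ y s, |y - w.1| ≤ C * r → dH (f (y, t)) (pt p' v' 0 s) < ε * r / 8 →
      |perpC p v (pt p' v' 0 s)| ≤ 2 * M * r ∧
      |vertC p v (pt p' v' 0 s)| ≤ 2 * (2 * M * r) ^ 2 := by
    intro y s hy hs
    obtain ⟨z, hz, h⟩ := hnear₀ y hy
    rw [hLeq] at hz
    obtain ⟨s', rfl⟩ := hz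
    refine near_line (s := s') hv (by positivity) ?_
    have h1 := dH_triangle (pt p' v' 0 s) (f (y, t)) (pt p v 0 s')
    have h2 := dH_triangle (f (y, t)) (f (y, w.2)) (pt p v 0 s')
    have h3 := (hf (y, t) (y, w.2)).2
    rw [dPar_same_y] at h3
    have h4 : Real.sqrt |t - w.2| ≤ r := Real.sqrt_le_iff.2 ⟨hr.le, ht⟩
    have h5 : M * Real.sqrt |t - w.2| ≤ M * r := mul_le_mul_of_nonneg_left h4 hM0.le
    rw [dH_comm] at h1
    rw [dH_comm (pt p' v' 0 s) (f (y, t)), dH_comm (pt p v 0 s') ] at h1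
    nlinarith
  have hdist : ∀ y y' s s', dH (f (y, t)) (pt p' v' 0 s) < ε * r / 8 →
      dH (f (y', t)) (pt p' v' 0 s') < ε * r / 8 →
      M⁻¹ * |y - y'| - r / 4 ≤ |s - s'| ∧ |s - s'| ≤ M * |y - y'| + r / 4 := by
    intro y y' s s' hs hs'
    have h1 := hf (y, t) (y', t)
    rw [dPar_same_t] at h1
    rw [← dH_pt p' v' hv' s s']
    have g1 := dH_triangle (f (y, t)) (pt p' v' 0 s) (f (y', t))
    have g2 := dH_triangle (pt p' v' 0 s) (pt p' v' 0 s') (f (y', t))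
    have g3 := dH_triangle (pt p' v' 0 s) (f (y, t)) (pt p' v' 0 s')
    have g4 := dH_triangle (f (y, t)) (f (y', t)) (pt p' v' 0 s')
    rw [dH_comm (pt p' v' 0 s') (f (y', t))] at g2
    rw [dH_comm (pt p' v' 0 s) (f (y, t))] at g3
    constructor <;> linarith [h1.1, h1.2]
  -- the two far away points
  have hy1 : |w.1 + C * r - w.1| ≤ C * r := by
    rw [add_sub_cancel_left, abs_of_pos (by positivity)]
  have hy2 : |w.1 - C * r - w.1| ≤ C * r := by
    rw [sub_sub_cancel_left, abs_neg, abs_of_pos (by positivity)]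
  obtain ⟨s₁, hs₁⟩ := hpar _ hy1
  obtain ⟨s₂, hs₂⟩ := hpar _ hy2
  obtain ⟨b1, T1⟩ := hcl _ _ hy1 hs₁
  obtain ⟨b2, T2⟩ := hcl _ _ hy2 hs₂
  rw [perp_pt] at b1 b2
  rw [vert_pt _ _ _ _ hv] at T1 T2
  set κ := 832 * M ^ 5 * r / C with hκ
  have hcs : (v'.1 * v.1 + v'.2 * v.2) ^ 2 + (-v'.1 * v.2 + v'.2 * v.1) ^ 2 = 1 := by
    linear_combination hv * (v'.1 ^ 2 + v'.2 ^ 2) + hv'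
  have hsep : ∀ a, (C - 1) * r ≤ a → C * r / (2 * M) ≤ M⁻¹ * a - r / 4 := by
    intro a ha
    have h1 : M⁻¹ * ((C - 1) * r) ≤ M⁻¹ * a := mul_le_mul_of_nonneg_left ha (by positivity)
    have h2 : C * r / (2 * M) ≤ M⁻¹ * ((C - 1) * r) - r / 4 := by
      rw [div_le_iff₀ (by positivity)]
      have : (M⁻¹ * ((C - 1) * r) - r / 4) * (2 * M) = (2 * (C - 1) - M / 2) * r := by
        field_simp
        ring
      rw [this]
      apply mul_le_mul_of_nonneg_right _ hr.le
      linarith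
    linarith
  have hperp : ∀ y s, |y - w.1| ≤ r → dH (f (y, t)) (pt p' v' 0 s) < ε * r / 8 →
      |perpC p v (pt p' v' 0 s)| ≤ κ := by
    intro y s hy hs
    have hy' : |y - w.1| ≤ C * r := le_trans hy hrC
    obtain ⟨b0, T0⟩ := hcl _ _ hy' hs
    rw [perp_pt] at b0 ⊢
    rw [vert_pt _ _ _ _ hv] at T0
    obtain ⟨l1, u1⟩ := hdist _ _ _ _ hs hs₁
    obtain ⟨l2, u2⟩ := hdist _ _ _ _ hs hs₂
    obtain ⟨l3, u3⟩ := hdist _ _ _ _ hs₁ hs₂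
    have hyl := abs_le.1 hy
    have a1 : (C - 1) * r ≤ |y - (w.1 + C * r)| := by
      rw [abs_sub_comm]
      refine le_trans ?_ (le_abs_self _)
      linarith
    have a1' : |y - (w.1 + C * r)| ≤ (C + 1) * r := by
      rw [abs_le]
      constructor <;> linarith
    have a2 : (C - 1) * r ≤ |y - (w.1 - C * r)| := by
      refine le_trans ?_ (le_abs_self _)
      linarith
    have a3 : (C - 1) * r ≤ |w.1 + C * r - (w.1 - C * r)| := by
      refine le_trans ?_ (le_abs_self _)
      have : 0 < C * r := by positivity
      linarith
    have hD : |s - s₁| ≤ 3 * M * C * r := by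
      have : M * |y - (w.1 + C * r)| ≤ M * ((C + 1) * r) :=
        mul_le_mul_of_nonneg_left a1' hM0.le
      have h2 : M * (C + 1) + 1 / 4 ≤ 3 * M * C := by nlinarith
      have h3 := mul_le_mul_of_nonneg_right h2 hr.le
      linarith
    have hcore := core (K := 2 * M * r) (Λ := C * r / (2 * M)) (D := 3 * M * C * r) hcs
      (by positivity) (by positivity) ?_ b1 b2 T0 T1 T2
      (le_trans (hsep _ a1) l1) (le_trans (hsep _ a2) l2) (le_trans (hsep _ a3) l3) hD
    · refine le_trans hcore ?_
      have e : 8 * (2 * M * r) ^ 2 / (C * r / (2 * M)) +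
          16 * (2 * M * r) ^ 2 * (3 * M * C * r) / (C * r / (2 * M)) ^ 2 =
          (64 * M ^ 3 + 768 * M ^ 5) * r / C := by
        field_simp
        ring
      rw [e, hκ]
      have : M ^ 3 ≤ M ^ 5 := pow_le_pow_right₀ hM (by norm_num)
      gcongr
      linarith
    · rw [le_div_iff₀ (by positivity)]
      have : 4 * (2 * M * r) * (2 * M) = 16 * M ^ 2 * r := by ring
      rw [this]
      apply mul_le_mul_of_nonneg_right _ hr.le
      linarith
  have hκM : κ * (3 * M * r) ≤ (ε / 4 * r) ^ 2 := by
    have e : κ * (3 * M * r) = 2496 * M ^ 6 / C * r ^ 2 := by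
      rw [hκ]
      field_simp
      ring
    rw [e, mul_pow]
    apply mul_le_mul_of_nonneg_right _ (by positivity)
    rw [div_le_iff₀ hC0]
    nlinarith
  have hκ1 : κ ≤ ε / 4 * r := by
    have h5 : M ^ 5 ≤ M ^ 6 := pow_le_pow_right₀ hM (by norm_num)
    rw [hκ, div_le_iff₀ hC0]
    have h6 : 832 * M ^ 5 ≤ ε / 4 * C := by
      have : C * ε ^ 2 ≤ C * ε := mul_le_mul_of_nonneg_left (by nlinarith) hC0.le
      linarith
    nlinarith
  have hw0 : |w.1 - w.1| ≤ C * r := by simp; positivity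
  have hw0' : |w.1 - w.1| ≤ r := by simp; positivity
  obtain ⟨s₀, hs₀⟩ := hpar _ hw0
  have hp0 := hperp _ _ hw0' hs₀
  refine ⟨Set.range (pt p v (vertC p v (pt p' v' 0 s₀))), isLine_pt p v hv _, ?_, ?_⟩
  · rw [hLeq]
    exact pt_sub_span _ _ _
  rintro _ ⟨⟨y, t'⟩, ⟨hx1, hx2⟩, rfl⟩
  obtain rfl : t' = t := hx1
  have hy : |y - w.1| ≤ r := le_trans (le_max_left _ _) hx2
  have hy' : |y - w.1| ≤ C * r := le_trans hy hrC
  obtain ⟨s, hs⟩ := hpar y hy'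
  have hp := hperp _ _ hy hs
  obtain ⟨-, u⟩ := hdist _ _ _ _ hs hs₀
  have hT : |vertC p v (pt p' v' 0 s) - vertC p v (pt p' v' 0 s₀)| ≤ (ε / 4 * r) ^ 2 := by
    refine le_trans ?_ hκM
    have e : vertC p v (pt p' v' 0 s) - vertC p v (pt p' v' 0 s₀) =
        -(v'.1 * v.1 + v'.2 * v.2) * (((perpC p v (pt p' v' 0 s) +
          perpC p v (pt p' v' 0 s₀)) / 2) * (s - s₀)) := by
      rw [vert_pt _ _ _ _ hv, vert_pt _ _ _ _ hv, perp_pt, perp_pt]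
      ring
    have hc1 : |-(v'.1 * v.1 + v'.2 * v.2)| ≤ 1 := by
      rw [abs_neg]
      apply abs_le_of_sq_le_sq _ zero_le_one
      nlinarith [sq_nonneg (-v'.1 * v.2 + v'.2 * v.1)]
    have hm : |(perpC p v (pt p' v' 0 s) + perpC p v (pt p' v' 0 s₀)) / 2| ≤ κ := by
      rw [abs_le] at hp hp0 ⊢
      constructor <;> linarith [hp.1, hp.2, hp0.1, hp0.2]
    have hss : |s - s₀| ≤ 3 * M * r := by
      have : M * |y - w.1| ≤ M * r := mul_le_mul_of_nonneg_left hy hM0.le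
      nlinarith
    rw [e, abs_mul, abs_mul]
    have h1 := mul_le_mul hm hss (abs_nonneg _) (le_trans (abs_nonneg _) hp)
    have h2 := mul_le_mul hc1 h1 (by positivity) zero_le_one
    linarith
  refine mem_NH ⟨_, rfl⟩ (le_trans (dH_triangle _ (pt p' v' 0 s) _)
    (le_trans (add_le_add hs.le (close_line hv (by positivity) (le_trans hp hκ1) hT)) ?_))
  nlinarith [mul_pos hε hr]

/-- **Proposition 3.6.** Small ruler coefficients imply small strong vertical
β-numbers. -/
theorem small_ruler_implies_small_beta :
    ∀ M : ℝ, 1 ≤ M → ∀ ε : ℝ, 0 < ε → ε ≤ 1 →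
      ∃ C : ℝ, 10 ≤ C ∧ ∃ δ > (0 : ℝ),
        ∀ f : ℝ × ℝ → Hei, IsBilipschitz M f →
          ∀ w : ℝ × ℝ, ∀ r > (0 : ℝ),
            rulerCoef f w (C * r) < δ → beta f w r < ε := by
  intro M hM ε hε hε1
  have hM6 : 1 ≤ M ^ 6 := one_le_pow₀ hM
  have hε2 : ε ^ 2 ≤ 1 := pow_le_one₀ hε.le hε1
  have hC : 10 ≤ 40000 * M ^ 6 / ε ^ 2 := by
    rw [le_div_iff₀ (by positivity)]
    nlinarith
  refine ⟨40000 * M ^ 6 / ε ^ 2, hC, ε / (8 * (40000 * M ^ 6 / ε ^ 2)),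
    div_pos hε (by linarith), ?_⟩
  intro f hf w r hr hrul
  generalize hCC : 40000 * M ^ 6 / ε ^ 2 = C at *
  have hne : {ρ : ℝ | 0 < ρ ∧ ∀ t : ℝ, ∃ L : Set Hei, IsHorizontalLine L ∧
      f '' (lineW t ∩ BPar w (C * r)) ⊆ NH L (ρ * (C * r))}.Nonempty := by
    have hCr : 0 < C * r := by positivity
    refine ⟨M, by positivity, fun t => ⟨_, isLine_pt (f w) (1, 0) (by norm_num) 0, ?_⟩⟩
    rintro _ ⟨x, ⟨-, hx⟩, rfl⟩
    refine mem_NH (z := f w) ⟨0, by ext <;> simp [pt, Hmul]⟩ ?_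
    exact le_trans (hf x w).2 (mul_le_mul_of_nonneg_left hx (by linarith))
  obtain ⟨ρ, ⟨hρ0, hρ⟩, hρlt⟩ := exists_lt_of_csInf_lt hne hrul
  have hρ' : ρ * (C * r) < ε * r / 8 := by
    rw [lt_div_iff₀ (by linarith)] at hρlt
    nlinarith
  obtain ⟨V, hV, hVt⟩ := key hM hε hε1 hCC.symm hr hf w hρ' hρ
  have hb : betaV f V w r ≤ ε / 2 :=
    csInf_le ⟨0, fun x hx => hx.1.le⟩ ⟨by positivity, hVt⟩
  have hbeta : beta f w r ≤ betaV f V w r := by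
    refine csInf_le ⟨0, ?_⟩ ⟨V, hV, rfl⟩
    rintro _ ⟨V', -, rfl⟩
    exact Real.sInf_nonneg fun x hx => hx.1.le
  linarith

end HeisRug
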